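/- Let T > 0, let a, b, c, f : (0,T) × (0,1) → ℝ, and let u ∈ C⁰([0,T] × [0,1]) be such that, at a time t ∈ (0,T), u[t] ∈ C²((0,1)), ∂u/∂t(t,·) exists on (0,1), a(t,x) ≥ 0 for all x ∈ (0,1), and ∂u/∂t(t,x) = a(t,x)·∂²u/∂x²(t,x) + b(t,x)·∂u/∂x(t,x) + c(t,x)·u(t,x) + f(t,x) for all x ∈ (0,1). Then for every interior point x ∈ (0,1) with |u(t,x)| = ‖u[t]‖_∞, it holds that sgn(u(t,x))·∂u/∂t(t,x) ≤ c(t,x)·‖u[t]‖_∞ + |f(t,x)|. -/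

import Mathlib

open Set Filter

/-- Second-order necessary condition at an interior local maximum. -/
lemma second_order_max (g g1 : ℝ → ℝ) (g2 x : ℝ)
    (h1 : ∀ᶠ y in nhds x, HasDerivAt g (g1 y) y) (h2 : HasDerivAt g1 g2 x)
    (hm : IsLocalMax g x) : g1 x = 0 ∧ g2 ≤ 0 := by
  have h0 : g1 x = 0 := hm.hasDerivAt_eq_zero h1.self_of_nhds
  refine ⟨h0, ?_⟩
  by_contra! hpos
  have hd : deriv g =ᶠ[nhds x] g1 := h1.mono fun y hy => hy.deriv
  have hdd : deriv (deriv g) x = g2 := by rw [hd.deriv_eq, h2.deriv]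
  have hmin : IsLocalMin g x := isLocalMin_of_deriv_deriv_pos (by rw [hdd]; exact hpos)
    (by rw [hd.self_of_nhds, h0]) h1.self_of_nhds.continuousAt
  have hc : g =ᶠ[nhds x] fun _ => g x := by
    filter_upwards [hm, hmin] with y hy1 hy2
    exact le_antisymm hy1 hy2
  have hz := hc.deriv.deriv_eq
  simp at hz
  linarith

/-- **Implication (4.16)** in Karafyllis–Krstic: at a time `t` where the solution is
`C²` in `x` on `(0,1)`, satisfies the parabolic PDE with `a(t,·) ≥ 0`, every interior
point `x ∈ (0,1)` at which `|u(t,x)| = ‖u[t]‖_∞` satisfies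
`sgn(u(t,x))·∂u/∂t(t,x) ≤ c(t,x)·‖u[t]‖_∞ + |f(t,x)|`. -/
theorem impl4_16
    (T : ℝ) (hT : 0 < T)
    (a b c f : ℝ → ℝ → ℝ)
    (u ut ux uxx : ℝ → ℝ → ℝ)
    (hu_cont : ContinuousOn (fun p : ℝ × ℝ => u p.1 p.2) (Set.Icc 0 T ×ˢ Set.Icc 0 1))
    (t : ℝ) (ht : t ∈ Set.Ioo (0:ℝ) T)
    (hC2 : ∀ x ∈ Set.Ioo (0:ℝ) 1, HasDerivAt (u t) (ux t x) x)
    (hC2' : ∀ x ∈ Set.Ioo (0:ℝ) 1, HasDerivAt (ux t) (uxx t x) x)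
    (hC2'' : ContinuousOn (uxx t) (Set.Ioo 0 1))
    (hut : ∀ x ∈ Set.Ioo (0:ℝ) 1, HasDerivAt (fun τ => u τ x) (ut t x) t)
    (ha : ∀ x ∈ Set.Ioo (0:ℝ) 1, 0 ≤ a t x)
    (hpde : ∀ x ∈ Set.Ioo (0:ℝ) 1,
      ut t x = a t x * uxx t x + b t x * ux t x + c t x * u t x + f t x) :
    ∀ x ∈ Set.Ioo (0:ℝ) 1,
      |u t x| = sSup ((fun y => |u t y|) '' Set.Icc 0 1) →
      Real.sign (u t x) * ut t x ≤
        c t x * sSup ((fun y => |u t y|) '' Set.Icc 0 1) + |f t x| := by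
  intro x hx hmax
  have hnhds : Set.Ioo (0:ℝ) 1 ∈ nhds x := Ioo_mem_nhds hx.1 hx.2
  have hcont : ContinuousOn (u t) (Set.Icc 0 1) :=
    hu_cont.comp (f := fun y : ℝ => (t, y)) (by fun_prop)
      (fun y hy => ⟨⟨ht.1.le, ht.2.le⟩, hy⟩)
  have hbdd : BddAbove ((fun y => |u t y|) '' Set.Icc 0 1) :=
    isCompact_Icc.bddAbove_image hcont.abs
  have hle : ∀ᶠ y in nhds x, |u t y| ≤ |u t x| := by
    filter_upwards [hnhds] with y hy
    rw [hmax]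
    exact le_csSup hbdd ⟨y, ⟨hy.1.le, hy.2.le⟩, rfl⟩
  rw [← hmax]
  have hD : ∀ᶠ y in nhds x, HasDerivAt (u t) (ux t y) y := by
    filter_upwards [hnhds] with y hy using hC2 y hy
  have hax := ha x hx
  rcases lt_trichotomy (u t x) 0 with h | h | h
  · have hm : IsLocalMax (fun y => -u t y) x := by
      filter_upwards [hle] with y hy
      rw [abs_of_neg h] at hy
      exact (neg_le_abs _).trans hy
    obtain ⟨e1, e2⟩ := second_order_max _ (fun y => -ux t y) (-uxx t x) x
      (hD.mono fun y hy => hy.fun_neg) (hC2' x hx).fun_neg hm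
    have e1 : ux t x = 0 := by simpa using e1
    rw [Real.sign_of_neg h, abs_of_neg h, hpde x hx, e1]
    nlinarith [neg_le_abs (f t x), mul_nonneg hax (show 0 ≤ uxx t x by linarith)]
  · simp [h]
  · have hm : IsLocalMax (u t) x := by
      filter_upwards [hle] with y hy
      rw [abs_of_pos h] at hy
      exact (le_abs_self _).trans hy
    obtain ⟨e1, e2⟩ := second_order_max _ _ _ x hD (hC2' x hx) hm
    rw [Real.sign_of_pos h, abs_of_pos h, hpde x hx, e1]
    nlinarith [le_abs_self (f t x), mul_nonneg hax (show 0 ≤ -uxx t x by linarith)]
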